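/- arXiv:1608.01290 — 4 statements merged into one kernel-verified Lean document; each statement's English description precedes it below -/
import Mathlib

section
/- Let M be a module over a commutative ℚ-algebra R, and let d, δ₁, δ₂, D be R-linear endomorphisms of M satisfying: (i) d ∘ D − D ∘ d = δ₁ − δ₂; (ii) D ∘ δ₁ = δ₁ ∘ D and D ∘ δ₂ = δ₂ ∘ D; (iii) D is nilpotent, say D^N = 0. Then, with E = Σ_{n=0}^{N−1} (1/n!) • Dⁿ, one has (d + δ₂) ∘ E = E ∘ (d + δ₁). -/
/-!
Statement 7: If `[d, D] = δ₁ − δ₂`, `D` commutes with `δ₁` and `δ₂`, and `D` is nilpotent,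
then `exp(D)` intertwines the perturbed operators: `(d + δ₂) ∘ exp(D) = exp(D) ∘ (d + δ₁)`.
-/

theorem mul_pow_succ_of_commutator_commute {A : Type*} [Ring A] {d D c : A}
    (h : d * D = D * d + c) (hc : Commute c D) (n : ℕ) :
    d * D ^ (n + 1) = D ^ (n + 1) * d + (n + 1 : ℕ) • (D ^ n * c) := by
  induction n with
  | zero => simp [h]
  | succ n ih =>
    rw [pow_succ D (n + 1), ← mul_assoc, ih, add_mul, mul_assoc _ d D, h, smul_mul_assoc,
      mul_assoc _ c D, hc.eq, ← mul_assoc _ D c, ← pow_succ, succ_nsmul _ (n + 1), mul_add]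
    noncomm_ring

theorem algebraMap_inv_factorial_succ_mul (R : Type*) [CommRing R] [Algebra ℚ R] (n : ℕ) :
    algebraMap ℚ R (1 / ((n + 1).factorial : ℚ)) * ((n + 1 : ℕ) : R) =
      algebraMap ℚ R (1 / (n.factorial : ℚ)) := by
  rw [← map_natCast (algebraMap ℚ R) (n + 1), ← map_mul, Nat.factorial_succ]
  congr 1
  have := Nat.factorial_ne_zero n
  push_cast
  field_simp

theorem mul_sum_exp_of_commutator_commute (R : Type*) {A : Type*} [CommRing R] [Algebra ℚ R]
    [Ring A] [Algebra R A] {d D c : A} (h : d * D = D * d + c) (hc : Commute c D) (N : ℕ) :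
    d * ∑ n ∈ Finset.range (N + 1), algebraMap ℚ R (1 / (n.factorial : ℚ)) • D ^ n =
      (∑ n ∈ Finset.range (N + 1), algebraMap ℚ R (1 / (n.factorial : ℚ)) • D ^ n) * d +
        (∑ n ∈ Finset.range N, algebraMap ℚ R (1 / (n.factorial : ℚ)) • D ^ n) * c := by
  induction N with
  | zero => simp
  | succ N ih =>
    rw [Finset.sum_range_succ _ (N + 1), mul_add, ih, mul_smul_comm,
      mul_pow_succ_of_commutator_commute h hc, smul_add, ← Nat.cast_smul_eq_nsmul R, smul_smul,
      algebraMap_inv_factorial_succ_mul, Finset.sum_range_succ _ N]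
    simp only [add_mul, smul_mul_assoc]
    abel

theorem exp_intertwines_perturbed_differentials (R M : Type*) [CommRing R] [Algebra ℚ R]
    [AddCommGroup M] [Module R M]
    (d δ₁ δ₂ D : M →ₗ[R] M)
    (h₁ : d ∘ₗ D - D ∘ₗ d = δ₁ - δ₂)
    (h₂ : D ∘ₗ δ₁ = δ₁ ∘ₗ D)
    (h₃ : D ∘ₗ δ₂ = δ₂ ∘ₗ D)
    (N : ℕ) (hN : D ^ N = 0) :
    letI E : M →ₗ[R] M :=
      ∑ n ∈ Finset.range N, algebraMap ℚ R (1 / (n.factorial : ℚ)) • (D ^ n)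
    (d + δ₂) ∘ₗ E = E ∘ₗ (d + δ₁) := by
  set E : Module.End R M :=
    ∑ n ∈ Finset.range N, algebraMap ℚ R (1 / (n.factorial : ℚ)) • (D ^ n)
  simp only [← Module.End.mul_eq_comp] at h₁ h₂ h₃ ⊢
  have hc : Commute (δ₁ - δ₂) D := Commute.sub_left h₂.symm h₃.symm
  have key := mul_sum_exp_of_commutator_commute R (sub_eq_iff_eq_add'.mp h₁) hc N
  rw [Finset.sum_range_succ, hN, smul_zero, add_zero] at key
  have hE : δ₂ * E = E * δ₂ :=
    Commute.sum_right _ _ _ fun n _ => (Commute.pow_right h₃.symm n).smul_right _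
  change d * E = E * d + E * (δ₁ - δ₂) at key
  rw [add_mul, key, hE, mul_sub, mul_add]
  abel
end

section
/- Let R be a commutative ring, B a commutative bialgebra over R with comultiplication Δ, and ∂ : B → B an R-linear derivation (∂(ab) = ∂(a)·b + a·∂(b)). Suppose x₁, …, xₙ ∈ B are primitive elements (Δ(x_j) = x_j ⊗ 1 + 1 ⊗ x_j) such that Δ(∂x_j) = 1 ⊗ ∂x_j for each j. Then Δ(∂(x₁ ⋯ xₙ)) = (id ⊗ ∂)(Δ(x₁ ⋯ xₙ)), where id ⊗ ∂ denotes the induced endomorphism of B ⊗_R B. -/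
/-!
Statement 9: In a commutative bialgebra, if `∂` is a derivation and `x₁, …, xₙ` are
primitive elements with `Δ(∂ x_j) = 1 ⊗ ∂ x_j`, then
`Δ(∂(x₁ ⋯ xₙ)) = (id ⊗ ∂)(Δ(x₁ ⋯ xₙ))`.
-/

open TensorProduct

/-- If `D` satisfies the Leibniz rule, then so does `id ⊗ D`. -/
theorem map_id_leibniz {R A B : Type*} [CommRing R] [CommRing A] [Algebra R A] [CommRing B]
    [Algebra R B] (D : B →ₗ[R] B) (hD : ∀ a b : B, D (a * b) = D a * b + a * D b)
    (u v : A ⊗[R] B) :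
    TensorProduct.map LinearMap.id D (u * v) =
      TensorProduct.map LinearMap.id D u * v + u * TensorProduct.map LinearMap.id D v := by
  induction u with
  | zero => simp
  | add u₁ u₂ h₁ h₂ => simp only [add_mul, map_add, h₁, h₂]; abel
  | tmul a b =>
    induction v with
    | zero => simp
    | add v₁ v₂ h₁ h₂ => simp only [mul_add, map_add, h₁, h₂]; abel
    | tmul c d => simp [hD, tmul_add]

/-- The identity `Δ(D a) = (id ⊗ D)(Δ a)` passes to finite products if `D` is a derivation. -/
theorem comul_derivation_prod {R B ι : Type*} [CommRing R] [CommRing B]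
    [Bialgebra R B] (D : B →ₗ[R] B) (hD : ∀ a b : B, D (a * b) = D a * b + a * D b)
    (s : Finset ι) (x : ι → B)
    (h : ∀ j ∈ s, Coalgebra.comul (D (x j)) =
      TensorProduct.map LinearMap.id D (Coalgebra.comul (x j) : B ⊗[R] B)) :
    Coalgebra.comul (D (∏ j ∈ s, x j)) =
      TensorProduct.map LinearMap.id D (Coalgebra.comul (∏ j ∈ s, x j) : B ⊗[R] B) := by
  have h_one : D 1 = 0 := by simpa using hD 1 1
  refine Finset.prod_induction x (fun a => Coalgebra.comul (D a) =
    TensorProduct.map LinearMap.id D (Coalgebra.comul a : B ⊗[R] B)) ?_ ?_ h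
  · intro a b ha hb
    rw [hD, map_add, Bialgebra.comul_mul, Bialgebra.comul_mul, Bialgebra.comul_mul,
      map_id_leibniz D hD, ha, hb]
  · simp [h_one, Algebra.TensorProduct.one_def]

theorem comul_derivation_prod_primitives (R B : Type*) [CommRing R] [CommRing B]
    [Bialgebra R B] (D : B →ₗ[R] B)
    (hD : ∀ a b : B, D (a * b) = D a * b + a * D b)
    (n : ℕ) (x : Fin n → B)
    (hx : ∀ j, Coalgebra.comul (x j) = x j ⊗ₜ[R] 1 + 1 ⊗ₜ[R] x j)
    (hDx : ∀ j, Coalgebra.comul (D (x j)) = (1 : B) ⊗ₜ[R] D (x j)) :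
    Coalgebra.comul (D (∏ j, x j)) =
      TensorProduct.map LinearMap.id D (Coalgebra.comul (∏ j, x j) : B ⊗[R] B) := by
  have h_one : D 1 = 0 := by simpa using hD 1 1
  exact comul_derivation_prod D hD Finset.univ x fun j _ => by simp [hx, hDx, h_one]
end

section
/- Let n ≥ 1 and let Q be a multivariate real polynomial in n variables which is homogeneous of degree 2 and positive definite, meaning its evaluation satisfies Q(x) > 0 for every x ≠ 0 in ℝⁿ. Then for every index i and every multivariate real polynomial q, the function x ↦ ((∂q/∂x_i)(x) − q(x)·(∂Q/∂x_i)(x))·exp(−Q(x)) is integrable on ℝⁿ (with Lebesgue measure) and its integral over ℝⁿ equals 0. -/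
/-!
Statement 11: Divergences against the Gaussian-type measure `e^{−Q(x)}dⁿx` are integrable
and integrate to zero: for `Q` homogeneous of degree 2 and positive definite, and any
polynomial `q` and index `i`, the function
`x ↦ (∂q/∂x_i(x) − q(x)·∂Q/∂x_i(x))·exp(−Q(x))` is integrable on `ℝⁿ` with integral `0`.
-/

open MeasureTheory MvPolynomial

theorem MvPolynomial.IsHomogeneous.eval_smul_eq {σ R : Type*} [CommSemiring R]
    {p : MvPolynomial σ R} {k : ℕ} (hp : p.IsHomogeneous k) (c : R) (x : σ → R) :
    eval (c • x) p = c ^ k * eval x p := by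
  rw [eval_eq, eval_eq, Finset.mul_sum]
  refine Finset.sum_congr rfl fun d hd => ?_
  have hdeg : ∑ j ∈ d.support, d j = k := by
    rw [← hp (mem_support_iff.mp hd), Finsupp.weight_apply, Finsupp.sum]
    simp
  simp only [Pi.smul_apply, smul_eq_mul, mul_pow, Finset.prod_mul_distrib,
    Finset.prod_pow_eq_pow_sum, hdeg]
  ring

theorem MvPolynomial.hasLineDerivAt_eval {ι : Type*} [Fintype ι] [DecidableEq ι]
    (p : MvPolynomial ι ℝ) (i : ι) (x : ι → ℝ) :
    HasLineDerivAt ℝ (fun y => eval y p) (eval x (pderiv i p)) x (Pi.single i 1) := by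
  unfold HasLineDerivAt
  induction p using MvPolynomial.induction_on with
  | C a => simpa using hasDerivAt_const (0 : ℝ) a
  | add p q hp hq => simpa using hp.fun_add hq
  | mul_X p j hp =>
    have hX : HasDerivAt (fun t : ℝ => (x + t • (Pi.single i 1 : ι → ℝ)) j)
        ((Pi.single i 1 : ι → ℝ) j) 0 := by
      simpa using ((hasDerivAt_id (0 : ℝ)).mul_const ((Pi.single i 1 : ι → ℝ) j)).const_add (x j)
    simp only [map_mul, eval_X]
    refine (hp.fun_mul hX).congr_deriv ?_
    simp only [Derivation.leibniz, pderiv_X, smul_eq_mul, map_add, map_mul, eval_X, zero_smul,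
      add_zero]
    rcases eq_or_ne i j with rfl | hij
    · simp
      ring
    · simp [hij.symm]
      ring

theorem MvPolynomial.IsHomogeneous.exists_mul_sum_sq_le_eval {ι : Type*} [Fintype ι]
    {Q : MvPolynomial ι ℝ} (hQ : Q.IsHomogeneous 2) (hpos : ∀ x : ι → ℝ, x ≠ 0 → 0 < eval x Q) :
    ∃ c : ℝ, 0 < c ∧ ∀ x : ι → ℝ, c * ∑ j, x j ^ 2 ≤ eval x Q := by
  have hzero : eval (0 : ι → ℝ) Q = 0 := by
    simpa only [zero_smul, ne_eq, OfNat.ofNat_ne_zero, not_false_eq_true, zero_pow, zero_mul]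
      using hQ.eval_smul_eq (0 : ℝ) (0 : ι → ℝ)
  rcases isEmpty_or_nonempty ι with _ | _
  · exact ⟨1, one_pos, fun x => by rw [Subsingleton.elim x 0, hzero]; simp⟩
  obtain ⟨y, hy, hmin⟩ := (isCompact_sphere (0 : ι → ℝ) 1).exists_isMinOn
    (NormedSpace.sphere_nonempty.mpr zero_le_one) (continuous_eval Q).continuousOn
  have hy0 : 0 < eval y Q := hpos y (ne_zero_of_mem_unit_sphere ⟨y, hy⟩)
  have hcard : (0 : ℝ) < Fintype.card ι := by exact_mod_cast Fintype.card_pos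
  refine ⟨eval y Q / Fintype.card ι, div_pos hy0 hcard, fun x => ?_⟩
  rcases eq_or_ne x 0 with rfl | hx
  · rw [hzero]
    simp
  have hnorm : ‖x‖ ≠ 0 := norm_ne_zero_iff.mpr hx
  have hle : eval y Q ≤ eval (‖x‖⁻¹ • x) Q :=
    hmin (by simp [norm_smul, hnorm])
  have hsum : ∑ j, x j ^ 2 ≤ Fintype.card ι * ‖x‖ ^ 2 := by
    calc ∑ j, x j ^ 2 ≤ ∑ _j : ι, ‖x‖ ^ 2 := by
          refine Finset.sum_le_sum fun j _ => sq_le_sq' ?_ ?_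
          · exact (abs_le.mp (norm_le_pi_norm x j)).1
          · exact (abs_le.mp (norm_le_pi_norm x j)).2
      _ = Fintype.card ι * ‖x‖ ^ 2 := by simp
  calc eval y Q / Fintype.card ι * ∑ j, x j ^ 2
      ≤ eval y Q / Fintype.card ι * (Fintype.card ι * ‖x‖ ^ 2) := by gcongr
    _ = ‖x‖ ^ 2 * eval y Q := by field_simp
    _ ≤ ‖x‖ ^ 2 * eval (‖x‖⁻¹ • x) Q := by gcongr
    _ = eval x Q := by rw [← hQ.eval_smul_eq, smul_inv_smul₀ hnorm]

theorem integrable_pow_mul_exp_neg_mul_sq {c : ℝ} (hc : 0 < c) (k : ℕ) :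
    Integrable fun t : ℝ => t ^ k * Real.exp (-c * t ^ 2) := by
  simpa using integrable_rpow_mul_exp_neg_mul_sq hc
    (s := (k : ℝ)) (neg_one_lt_zero.trans_le k.cast_nonneg)

theorem MvPolynomial.integrable_eval_mul_exp_neg {ι : Type*} [Fintype ι] {f : (ι → ℝ) → ℝ}
    (hf : Continuous f) {c : ℝ} (hc : 0 < c) (hle : ∀ x, c * ∑ j, x j ^ 2 ≤ f x)
    (p : MvPolynomial ι ℝ) :
    Integrable fun x : ι → ℝ => eval x p * Real.exp (-f x) := by
  induction p using MvPolynomial.induction_on' with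
  | add p q hp hq => simpa [add_mul] using Integrable.fun_add hp hq
  | monomial d a =>
    have hprod : Integrable fun x : ι → ℝ => ∏ j, (x j ^ d j * Real.exp (-c * x j ^ 2)) :=
      Integrable.fintype_prod fun j => integrable_pow_mul_exp_neg_mul_sq hc (d j)
    refine (hprod.const_mul a).mono
      ((continuous_eval _).mul hf.neg.rexp).aestronglyMeasurable (.of_forall fun x => ?_)
    rw [eval_monomial, Finsupp.prod_fintype _ _ fun _ => pow_zero _, Finset.prod_mul_distrib,
      ← Real.exp_sum, ← Finset.mul_sum, ← mul_assoc, norm_mul, norm_mul (a * _),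
      Real.norm_of_nonneg (Real.exp_pos _).le, Real.norm_of_nonneg (Real.exp_pos _).le]
    gcongr
    linarith [hle x]

theorem integral_eq_zero_of_hasLineDerivAt_of_integrable {E : Type*} [NormedAddCommGroup E]
    [NormedSpace ℝ E] [FiniteDimensional ℝ E] [MeasurableSpace E] [BorelSpace E] {μ : Measure E}
    [μ.IsAddHaarMeasure] {g g' : E → ℝ} {v : E} (hg : Integrable g μ) (hg' : Integrable g' μ)
    (hderiv : ∀ x, HasLineDerivAt ℝ g (g' x) x v) : ∫ x, g' x ∂μ = 0 := by
  simpa using integral_bilinear_hasLineDerivAt_right_eq_neg_left_of_integrable (μ := μ)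
    (f := fun _ : E => (1 : ℝ)) (f' := fun _ => 0) (g := g) (g' := g') (v := v)
    (B := ContinuousLinearMap.mul ℝ ℝ) (by simp) (by simpa using hg') (by simpa using hg)
    (fun x _ => by simpa [HasLineDerivAt] using hasDerivAt_const (0 : ℝ) (1 : ℝ))
    (fun x _ => hderiv x)

theorem divergence_integral_zero (n : ℕ) (hn : 1 ≤ n)
    (Q : MvPolynomial (Fin n) ℝ) (hQ : Q.IsHomogeneous 2)
    (hpos : ∀ x : Fin n → ℝ, x ≠ 0 → 0 < MvPolynomial.eval x Q)
    (i : Fin n) (q : MvPolynomial (Fin n) ℝ) :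
    Integrable (fun x : Fin n → ℝ =>
      (MvPolynomial.eval x (MvPolynomial.pderiv i q) -
        MvPolynomial.eval x q * MvPolynomial.eval x (MvPolynomial.pderiv i Q)) *
        Real.exp (-(MvPolynomial.eval x Q))) ∧
    (∫ x : Fin n → ℝ,
      (MvPolynomial.eval x (MvPolynomial.pderiv i q) -
        MvPolynomial.eval x q * MvPolynomial.eval x (MvPolynomial.pderiv i Q)) *
        Real.exp (-(MvPolynomial.eval x Q))) = 0 := by
  obtain ⟨c, hc, hle⟩ := hQ.exists_mul_sum_sq_le_eval hpos
  have hint := integrable_eval_mul_exp_neg (continuous_eval Q) hc hle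
  have hdiv := hint (pderiv i q - q * pderiv i Q)
  simp only [map_sub, map_mul] at hdiv
  refine ⟨hdiv, integral_eq_zero_of_hasLineDerivAt_of_integrable (v := Pi.single i 1)
    (hint q) hdiv fun x => ?_⟩
  have hq := hasLineDerivAt_eval q i x
  have hexp := HasDerivAt.exp (HasDerivAt.neg (hasLineDerivAt_eval Q i x))
  refine (HasDerivAt.mul hq hexp).congr_deriv ?_
  simp
  ring
end

section
/- Let n ≥ 1 and let Q be a multivariate real polynomial in n variables which is homogeneous of degree 2 and positive definite (Q(x) > 0 for every x ≠ 0 in ℝⁿ). Then a multivariate real polynomial p satisfies ∫_{ℝⁿ} p(x)·exp(−Q(x)) dx = 0 if and only if there exist multivariate real polynomials q₁, …, qₙ with p = Σ_{i=1}^{n} (∂q_i/∂x_i − q_i·∂Q/∂x_i). -/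
/-!
Statement 12: For `Q` homogeneous of degree 2 and positive definite on `ℝⁿ`, a polynomial
`p` has vanishing Gaussian expectation `∫ p e^{−Q} = 0` if and only if `p` is a divergence:
`p = Σ_i (∂q_i/∂x_i − q_i·∂Q/∂x_i)` for some polynomials `q₁, …, qₙ`.
-/

open MeasureTheory MvPolynomial

namespace MvPolynomial

section Algebra

variable {σ R : Type*} [Fintype σ] [CommRing R]

/-- The divergence of a polynomial vector field with respect to the density `e^{-Q}`. -/
noncomputable def weightedDivergence (Q : MvPolynomial σ R) :
    (σ → MvPolynomial σ R) →ₗ[R] MvPolynomial σ R where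
  toFun q := ∑ i, (pderiv i (q i) - q i * pderiv i Q)
  map_add' p q := by
    rw [← Finset.sum_add_distrib]
    refine Finset.sum_congr rfl fun i _ => ?_
    simp only [Pi.add_apply, map_add]
    ring
  map_smul' r q := by
    simp only [Pi.smul_apply, Derivation.map_smul, smul_mul_assoc, ← smul_sub, Finset.smul_sum,
      RingHom.id_apply]

theorem weightedDivergence_apply (Q : MvPolynomial σ R) (q : σ → MvPolynomial σ R) :
    weightedDivergence Q q = ∑ i, (pderiv i (q i) - q i * pderiv i Q) :=
  rfl

/-- If every variable is a constant linear combination of the partial derivatives of `Q`, then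
every polynomial is a constant up to a divergence. -/
theorem span_one_sup_range_weightedDivergence {Q : MvPolynomial σ R} {B : Matrix σ σ R}
    (hB : ∀ j, X j = ∑ i, C (B j i) * pderiv i Q) :
    Submodule.span R {1} ⊔ LinearMap.range (weightedDivergence Q) = ⊤ := by
  set W := Submodule.span R {1} ⊔ LinearMap.range (weightedDivergence Q)
  have hmono : ∀ d : ℕ, ∀ s : σ →₀ ℕ, s.degree = d → ∀ a : R, monomial s a ∈ W := by
    intro d
    induction d using Nat.strong_induction_on with
    | _ d ih =>
    intro s hs a
    by_cases h0 : s = 0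
    · refine Submodule.mem_sup_left (Submodule.mem_span_singleton.2 ⟨a, ?_⟩)
      rw [h0, smul_eq_C_mul, mul_one]
      rfl
    obtain ⟨j, hj⟩ := Finsupp.ne_iff.1 h0
    obtain ⟨t, rfl⟩ : ∃ t, s = t + Finsupp.single j 1 :=
      ⟨_, (Finsupp.sub_add_single_one_cancel hj).symm⟩
    have hdeg : t.degree + 1 = d := by simpa using hs
    have key : monomial (t + Finsupp.single j 1) a =
        ∑ i, B j i • pderiv i (monomial t a) -
          weightedDivergence Q fun i => B j i • monomial t a := by
      rw [monomial_add_single, pow_one, hB j, weightedDivergence_apply, Finset.mul_sum,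
        ← Finset.sum_sub_distrib]
      refine Finset.sum_congr rfl fun i _ => ?_
      rw [Derivation.map_smul, smul_eq_C_mul, smul_eq_C_mul]
      ring
    rw [key]
    refine W.sub_mem (W.sum_mem fun i _ => W.smul_mem _ ?_)
      (Submodule.mem_sup_right (LinearMap.mem_range_self _ _))
    rw [pderiv_monomial]
    refine ih _ ?_ _ rfl _
    have := Finsupp.degree_mono (tsub_le_self : t - Finsupp.single i 1 ≤ t)
    omega
  refine eq_top_iff.2 fun p _ => ?_
  induction p using induction_on' with
  | monomial s a => exact hmono _ s rfl a
  | add p q hp hq => exact W.add_mem (hp trivial) (hq trivial)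

theorem IsHomogeneous.pderiv_eq_sum {Q : MvPolynomial σ R} (hQ : Q.IsHomogeneous 2) (i : σ) :
    pderiv i Q = ∑ j, C (coeff 0 (pderiv j (pderiv i Q))) * X j := by
  have h := (hQ.pderiv (i := i)).sum_X_mul_pderiv
  rw [Nat.add_sub_cancel (m := 1) (n := 1), one_smul] at h
  conv_lhs => rw [← h]
  refine Finset.sum_congr rfl fun j _ => ?_
  rw [mul_comm]
  congr 1
  exact totalDegree_eq_zero_iff_eq_C.1
    ((totalDegree_zero_iff_isHomogeneous _).2 (hQ.pderiv (i := i)).pderiv)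

theorem IsHomogeneous.eval_smul {Q : MvPolynomial σ R} {k : ℕ} (hQ : Q.IsHomogeneous k) (r : R)
    (x : σ → R) : eval (r • x) Q = r ^ k * eval x Q := by
  rw [eval_eq', eval_eq', Finset.mul_sum]
  refine Finset.sum_congr rfl fun d hd => ?_
  have hk : ∑ i, d i = k := by
    rw [← hQ (mem_support_iff.1 hd), Finsupp.weight_apply, Finsupp.sum_fintype _ _ (by simp)]
    simp
  simp only [Pi.smul_apply, smul_eq_mul, mul_pow, Finset.prod_mul_distrib,
    Finset.prod_pow_eq_pow_sum, hk]
  ring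

end Algebra

theorem hasLineDerivAt_eval_s12 {σ : Type*} [DecidableEq σ] (p : MvPolynomial σ ℝ) (x : σ → ℝ)
    (i : σ) :
    HasLineDerivAt ℝ (fun y => eval y p) (eval x (pderiv i p)) x (Pi.single i 1) := by
  unfold HasLineDerivAt
  induction p using MvPolynomial.induction_on with
  | C a => simpa using hasDerivAt_const (0 : ℝ) a
  | add p q hp hq => simpa using hp.fun_add hq
  | mul_X p j hp =>
    have hX : HasDerivAt (fun t : ℝ => eval (x + t • Pi.single i 1) (X j))
        (eval x (pderiv i (X j))) 0 := by
      rcases eq_or_ne j i with rfl | hne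
      · simpa using (hasDerivAt_id (0 : ℝ)).const_add (x j)
      · simpa [hne, pderiv_X_of_ne hne] using hasDerivAt_const (0 : ℝ) (x j)
    rw [pderiv_mul, map_add, map_mul, map_mul]
    simpa using hp.fun_mul hX

section Real

variable {σ : Type*} [Fintype σ] {Q : MvPolynomial σ ℝ}

theorem IsHomogeneous.exists_X_eq_sum_pderiv (hQ : Q.IsHomogeneous 2)
    (hpos : ∀ x : σ → ℝ, x ≠ 0 → 0 < eval x Q) :
    ∃ B : Matrix σ σ ℝ, ∀ j, X j = ∑ i, C (B j i) * pderiv i Q := by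
  classical
  set A : Matrix σ σ ℝ := Matrix.of fun i j => coeff 0 (pderiv j (pderiv i Q)) with hA
  have hpd : ∀ i, pderiv i Q = ∑ j, C (A i j) * X j := fun i => hQ.pderiv_eq_sum i
  have hinj : Function.Injective A.mulVec := by
    refine (injective_iff_map_eq_zero A.mulVecLin).2 fun x hx => ?_
    by_contra hne
    have hgrad : ∀ i, eval x (pderiv i Q) = 0 := fun i => by
      rw [hpd i]
      simpa [Matrix.mulVec, dotProduct] using congrFun hx i
    have h := congrArg (eval x) hQ.sum_X_mul_pderiv
    simp only [map_sum, map_mul, hgrad, mul_zero, Finset.sum_const_zero, map_nsmul] at h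
    have := hpos x hne
    simp at h
    linarith
  obtain ⟨B, hBA⟩ := (Matrix.mulVec_injective_iff_isUnit.1 hinj).exists_left_inv
  refine ⟨B, fun j => ?_⟩
  simp_rw [hpd, Finset.mul_sum, ← mul_assoc, ← MvPolynomial.C_mul]
  rw [Finset.sum_comm]
  simp_rw [← Finset.sum_mul, ← map_sum, ← Matrix.mul_apply, hBA, Matrix.one_apply]
  simp

theorem IsHomogeneous.exists_pos_mul_sum_sq_le_eval (hQ : Q.IsHomogeneous 2)
    (hpos : ∀ x : σ → ℝ, x ≠ 0 → 0 < eval x Q) :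
    ∃ c > 0, ∀ x : σ → ℝ, c * ∑ i, x i ^ 2 ≤ eval x Q := by
  obtain ⟨c, hc, hcQ⟩ := (isCompact_sphere (0 : σ → ℝ) 1).exists_forall_le'
    (continuous_eval Q).continuousOn (a := 0)
    fun x hx => hpos x (ne_zero_of_mem_unit_sphere ⟨x, hx⟩)
  refine ⟨c / (Fintype.card σ + 1), by positivity, fun x => ?_⟩
  rcases eq_or_ne x 0 with rfl | hx
  · have h := hQ.eval_smul 0 0
    rw [smul_zero] at h
    rw [h]
    simp
  have hn : 0 < ‖x‖ := norm_pos_iff.2 hx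
  have h1 : c * ‖x‖ ^ 2 ≤ eval x Q := by
    have h := hcQ (‖x‖⁻¹ • x) (by simp [norm_smul, hn.ne'])
    rw [hQ.eval_smul, inv_pow, ← div_eq_inv_mul, le_div_iff₀ (by positivity)] at h
    exact h
  have h2 : ∑ i, x i ^ 2 ≤ Fintype.card σ * ‖x‖ ^ 2 := by
    rw [← nsmul_eq_mul]
    refine Finset.sum_le_card_nsmul _ _ _ fun i _ => ?_
    rw [← sq_abs]
    gcongr
    exact norm_le_pi_norm x i
  refine le_trans ?_ h1
  rw [div_mul_eq_mul_div, div_le_iff₀ (by positivity)]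
  nlinarith [sq_nonneg ‖x‖]

theorem integrable_eval_mul_exp_neg_mul_sum_sq (p : MvPolynomial σ ℝ) {c : ℝ} (hc : 0 < c) :
    Integrable fun x : σ → ℝ => eval x p * Real.exp (-(c * ∑ i, x i ^ 2)) := by
  induction p using induction_on' with
  | monomial s a =>
    have h : Integrable fun x : σ → ℝ => ∏ i, (x i ^ s i * Real.exp (-c * x i ^ 2)) :=
      Integrable.fintype_prod (f := fun i (v : ℝ) => v ^ s i * Real.exp (-c * v ^ 2)) fun i => by
        simpa using integrable_rpow_mul_exp_neg_mul_sq hc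
          (show (-1 : ℝ) < (s i : ℝ) by linarith [(s i).cast_nonneg (α := ℝ)])
    convert h.const_mul a using 2 with x
    rw [eval_monomial, Finset.prod_mul_distrib, ← Real.exp_sum, ← Finset.mul_sum,
      Finsupp.prod_fintype _ _ (by simp), neg_mul, mul_assoc]
  | add p q hp hq =>
    simpa only [map_add, add_mul] using hp.fun_add hq

theorem IsHomogeneous.integrable_eval_mul_exp_neg_eval (hQ : Q.IsHomogeneous 2)
    (hpos : ∀ x : σ → ℝ, x ≠ 0 → 0 < eval x Q) (p : MvPolynomial σ ℝ) :
    Integrable fun x : σ → ℝ => eval x p * Real.exp (-(eval x Q)) := by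
  obtain ⟨c, hc, hcQ⟩ := hQ.exists_pos_mul_sum_sq_le_eval hpos
  refine (integrable_eval_mul_exp_neg_mul_sum_sq p hc).mono
    ((continuous_eval p).mul (continuous_eval Q).neg.rexp).aestronglyMeasurable
    (.of_forall fun x => ?_)
  rw [norm_mul, norm_mul, Real.norm_of_nonneg (Real.exp_pos _).le,
    Real.norm_of_nonneg (Real.exp_pos _).le]
  gcongr
  exact hcQ x

theorem IsHomogeneous.integral_weightedDivergence (hQ : Q.IsHomogeneous 2)
    (hpos : ∀ x : σ → ℝ, x ≠ 0 → 0 < eval x Q) (q : σ → MvPolynomial σ ℝ) :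
    ∫ x : σ → ℝ, eval x (weightedDivergence Q q) * Real.exp (-(eval x Q)) = 0 := by
  classical
  have hint := hQ.integrable_eval_mul_exp_neg_eval hpos
  simp_rw [weightedDivergence_apply, map_sum, Finset.sum_mul]
  rw [integral_finsetSum _ fun i _ => hint _]
  refine Finset.sum_eq_zero fun i _ => ?_
  have hexp : ∀ x : σ → ℝ, HasLineDerivAt ℝ (fun y => Real.exp (-(eval y Q)))
      (Real.exp (-(eval x Q)) * -eval x (pderiv i Q)) x (Pi.single i 1) := fun x => by
    simpa [HasLineDerivAt] using (HasDerivAt.fun_neg (hasLineDerivAt_eval_s12 Q x i)).exp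
  have hq' : Integrable fun x : σ → ℝ =>
      eval x (q i) * (Real.exp (-(eval x Q)) * -eval x (pderiv i Q)) := by
    convert (hint (q i * pderiv i Q)).neg using 2 with x
    simp only [map_mul, Pi.neg_apply]
    ring
  have h := integral_bilinear_hasLineDerivAt_right_eq_neg_left_of_integrable
    (μ := volume) (B := ContinuousLinearMap.mul ℝ ℝ) (hint (pderiv i (q i))) hq' (hint (q i))
    (fun x _ => hasLineDerivAt_eval_s12 (q i) x i) (fun x _ => hexp x)
  simp only [ContinuousLinearMap.mul_apply'] at h
  have hsplit : ∀ x : σ → ℝ,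
      eval x (pderiv i (q i) - q i * pderiv i Q) * Real.exp (-(eval x Q)) =
        eval x (pderiv i (q i)) * Real.exp (-(eval x Q)) +
          eval x (q i) * (Real.exp (-(eval x Q)) * -eval x (pderiv i Q)) := fun x => by
    simp only [map_sub, map_mul]
    ring
  simp_rw [hsplit]
  rw [integral_add (hint _) hq', h, add_neg_cancel]

end Real

end MvPolynomial

theorem integral_zero_iff_divergence (n : ℕ) (hn : 1 ≤ n)
    (Q : MvPolynomial (Fin n) ℝ) (hQ : Q.IsHomogeneous 2)
    (hpos : ∀ x : Fin n → ℝ, x ≠ 0 → 0 < MvPolynomial.eval x Q)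
    (p : MvPolynomial (Fin n) ℝ) :
    (∫ x : Fin n → ℝ, MvPolynomial.eval x p * Real.exp (-(MvPolynomial.eval x Q))) = 0 ↔
      ∃ q : Fin n → MvPolynomial (Fin n) ℝ,
        p = ∑ i, (MvPolynomial.pderiv i (q i) - q i * MvPolynomial.pderiv i Q) := by
  constructor
  · intro hp
    obtain ⟨B, hB⟩ := hQ.exists_X_eq_sum_pderiv hpos
    have hmem := (span_one_sup_range_weightedDivergence hB).ge (Submodule.mem_top (x := p))
    obtain ⟨u, hu, v, ⟨q, rfl⟩, rfl⟩ := Submodule.mem_sup.1 hmem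
    obtain ⟨r, rfl⟩ := Submodule.mem_span_singleton.1 hu
    have hint := hQ.integrable_eval_mul_exp_neg_eval hpos
    have hexp : Integrable fun x : Fin n → ℝ => Real.exp (-(eval x Q)) := by
      simpa using hint 1
    simp_rw [map_add, add_mul] at hp
    rw [integral_add (hint _) (hint _), hQ.integral_weightedDivergence hpos, add_zero] at hp
    simp only [smul_eval, map_one, mul_one, integral_const_mul] at hp
    have hr : r = 0 := (mul_eq_zero.1 hp).resolve_right (integral_exp_pos hexp).ne'
    exact ⟨q, by rw [hr, zero_smul, zero_add, weightedDivergence_apply]⟩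
  · rintro ⟨q, rfl⟩
    exact hQ.integral_weightedDivergence hpos q
end
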